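/- Let G be a finite simple graph, S a nonempty finite set of automorphisms of G, and γ a fractional perfect matching of G with maximum fractional forcing number, i.e., f_f(G,γ) = F_f(G). Define γ₀ = (1/|S|) Σ_{σ∈S} γ_σ, where γ_σ(e) = γ(σ(e)). Then: (1) γ₀ is a fractional perfect matching of G; and (2) f_f(G,γ₀) = f_f(G,γ). -/

import Mathlib

open Finset

variable {V : Type} [Fintype V] [DecidableEq V]

/-- The sum of `γ` over the edges of `G` incident with the vertex `v`.
(Functions on `E(G)` are encoded as functions on `Sym2 V` vanishing off the edge set.) -/
def vertexSum (G : SimpleGraph V) [DecidableRel G.Adj] (γ : Sym2 V → ℝ) (v : V) : ℝ :=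
  ∑ e ∈ G.edgeFinset, if v ∈ e then γ e else 0

/-- `γ` is a fractional perfect matching of `G`. -/
def IsFPM (G : SimpleGraph V) [DecidableRel G.Adj] (γ : Sym2 V → ℝ) : Prop :=
  (∀ e, 0 ≤ γ e) ∧ (∀ e ∉ G.edgeSet, γ e = 0) ∧ ∀ v, vertexSum G γ v = 1

/-- `α ↑ γ` : `α` is a (nonnegative) forcing function for the fractional perfect matching
`γ`, i.e. `α ⪯ γ` and `γ` is the unique fractional perfect matching `γ'` with `α ⪯ γ'`. -/
def IsForcing (G : SimpleGraph V) [DecidableRel G.Adj] (α γ : Sym2 V → ℝ) : Prop :=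
  (∀ e, 0 ≤ α e) ∧ (∀ e ∉ G.edgeSet, α e = 0) ∧ α ≤ γ ∧
    ∀ γ', IsFPM G γ' → α ≤ γ' → γ' = γ

/-- `|α|`, the sum of the values of `α` over all edges of `G`. -/
def eSum (G : SimpleGraph V) [DecidableRel G.Adj] (α : Sym2 V → ℝ) : ℝ :=
  ∑ e ∈ G.edgeFinset, α e

/-- The fractional forcing number `f_f(G,γ) = min {|α| : α ↑ γ}`. -/
noncomputable def ffN (G : SimpleGraph V) [DecidableRel G.Adj] (γ : Sym2 V → ℝ) : ℝ :=
  sInf {x : ℝ | ∃ α, IsForcing G α γ ∧ x = eSum G α}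

/-- `f_f(G)`, the minimum of `f_f(G,γ)` over all fractional perfect matchings `γ`. -/
noncomputable def ffMin (G : SimpleGraph V) [DecidableRel G.Adj] : ℝ :=
  sInf {x : ℝ | ∃ γ, IsFPM G γ ∧ ffN G γ = x}

/-- `F_f(G)`, the maximum of `f_f(G,γ)` over all fractional perfect matchings `γ`. -/
noncomputable def ffMax (G : SimpleGraph V) [DecidableRel G.Adj] : ℝ :=
  sSup {x : ℝ | ∃ γ, IsFPM G γ ∧ ffN G γ = x}

section Averaging

theorem sum_edgeFinset_map_iso {W : Type*} (G : SimpleGraph W) [Fintype G.edgeSet] (σ : G ≃g G)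
    (f : Sym2 W → ℝ) :
    ∑ e ∈ G.edgeFinset, f (Sym2.map σ e) = ∑ e ∈ G.edgeFinset, f e := by
  refine Finset.sum_nbij' (Sym2.map σ) (Sym2.map σ.symm) ?_ ?_ ?_ ?_ fun _ _ => rfl
  all_goals
    intro e
    induction e with
    | _ a b => simp [SimpleGraph.Iso.map_adj_iff]

theorem map_iso_mem_edgeSet_iff {W : Type*} (G : SimpleGraph W) (σ : G ≃g G)
    (e : Sym2 W) :
    Sym2.map σ e ∈ G.edgeSet ↔ e ∈ G.edgeSet := by
  induction e with
  | _ a b => simp [SimpleGraph.Iso.map_adj_iff]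

variable (G : SimpleGraph V) [DecidableRel G.Adj]

theorem vertexSum_add_smul (γ h : Sym2 V → ℝ) (c : ℝ) (v : V) :
    vertexSum G (fun e => γ e + c * h e) v = vertexSum G γ v + c * vertexSum G h v := by
  simp only [vertexSum, Finset.mul_sum, ← Finset.sum_add_distrib]
  refine Finset.sum_congr rfl fun e _ => ?_
  split_ifs <;> ring

theorem vertexSum_map_iso (σ : G ≃g G) (γ : Sym2 V → ℝ) (v : V) :
    vertexSum G (fun e => γ (Sym2.map σ e)) v = vertexSum G γ (σ v) := by
  rw [vertexSum, vertexSum,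
    ← sum_edgeFinset_map_iso G σ fun e => if σ v ∈ e then γ e else 0]
  refine Finset.sum_congr rfl fun e _ => ?_
  simp [Sym2.mem_map]

theorem vertexSum_average {ι : Type*} (S : Finset ι) (c : ℝ) (f : ι → Sym2 V → ℝ) (v : V) :
    vertexSum G (fun e => c * ∑ i ∈ S, f i e) v = c * ∑ i ∈ S, vertexSum G (f i) v := by
  simp only [vertexSum]
  rw [Finset.sum_comm, Finset.mul_sum]
  refine Finset.sum_congr rfl fun e _ => ?_
  split_ifs <;> simp

/-- `T` is a forcing set of edges if zero is the only function on the edges with vanishing vertex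
sums that is nonnegative on `T`. -/
def IsForcingSet (T : Set (Sym2 V)) : Prop :=
  ∀ h : Sym2 V → ℝ, (∀ e ∉ G.edgeSet, h e = 0) → (∀ v, vertexSum G h v = 0) →
    (∀ e ∈ T, 0 ≤ h e) → h = 0

variable {G}

theorem IsForcing.isForcingSet_tight {α γ : Sym2 V → ℝ} (hγ : IsFPM G γ)
    (hα : IsForcing G α γ) : IsForcingSet G {e | α e = γ e} := by
  intro h hsupp hsum hpos
  obtain ⟨hα0, -, hle, huniq⟩ := hα
  have hev : ∀ᶠ ε : ℝ in nhdsWithin 0 (Set.Ioi 0), ∀ e, α e ≤ γ e + ε * h e := by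
    rw [Filter.eventually_all]
    intro e
    by_cases he : α e = γ e
    · filter_upwards [self_mem_nhdsWithin] with ε hε
      have := mul_nonneg (le_of_lt hε) (hpos e he)
      linarith
    · have hlt : α e < γ e + 0 * h e := by simpa using lt_of_le_of_ne (hle e) he
      have hc : Continuous fun ε : ℝ => γ e + ε * h e := by fun_prop
      exact (hc.continuousAt.eventually_const_lt hlt).filter_mono nhdsWithin_le_nhds
        |>.mono fun _ => le_of_lt
  obtain ⟨ε, hε, hε0⟩ := (hev.and self_mem_nhdsWithin).exists
  have key := huniq (fun e => γ e + ε * h e)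
    ⟨fun e => (hα0 e).trans (hε e), fun e he => by simp [hγ.2.1 e he, hsupp e he],
      fun v => by rw [vertexSum_add_smul, hγ.2.2, hsum]; simp⟩ hε
  funext e
  have := congrFun key e
  have hne : ε ≠ 0 := ne_of_gt hε0
  simpa [hne] using this

theorem IsForcingSet.isForcing_indicator {T : Set (Sym2 V)} (hT : IsForcingSet G T)
    {γ : Sym2 V → ℝ} (hγ : IsFPM G γ) : IsForcing G (T.indicator γ) γ := by
  refine ⟨fun e => Set.indicator_nonneg (fun e _ => hγ.1 e) e, fun e he => ?_,
    Set.indicator_le_self' fun e _ => hγ.1 e, fun γ' hγ' hle => ?_⟩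
  · simp [hγ.2.1 e he]
  · have h0 := hT (fun e => γ' e + (-1) * γ e)
      (fun e he => by simp [hγ.2.1 e he, hγ'.2.1 e he])
      (fun v => by rw [vertexSum_add_smul, hγ.2.2, hγ'.2.2]; ring)
      (fun e he => by
        have := hle e
        rw [Set.indicator_of_mem he] at this
        linarith)
    funext e
    have := congrFun h0 e
    simp only [Pi.zero_apply] at this
    linarith

theorem IsForcingSet.preimage_map_iso {T : Set (Sym2 V)} (hT : IsForcingSet G T) (σ : G ≃g G) :
    IsForcingSet G (Sym2.map σ ⁻¹' T) := by
  intro h hsupp hsum hpos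
  have hinv : ∀ e, Sym2.map σ (Sym2.map σ.symm e) = e := fun e => by
    induction e with
    | _ a b => simp
  have hinv' : ∀ e, Sym2.map σ.symm (Sym2.map σ e) = e := fun e => by
    induction e with
    | _ a b => simp
  have h0 := hT (fun e => h (Sym2.map σ.symm e))
    (fun e he => hsupp _ (by rwa [map_iso_mem_edgeSet_iff]))
    (fun v => by rw [vertexSum_map_iso, hsum])
    (fun e he => hpos _ (by rwa [Set.mem_preimage, hinv]))
  funext e
  simpa [hinv'] using congrFun h0 (Sym2.map σ e)

theorem IsFPM.isForcing_self {γ : Sym2 V → ℝ} (hγ : IsFPM G γ) : IsForcing G γ γ := by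
  refine ⟨hγ.1, hγ.2.1, le_rfl, fun γ' hγ' hle => ?_⟩
  funext e
  by_cases he : e ∈ G.edgeSet
  · obtain ⟨v, hv⟩ : ∃ v, v ∈ e := by
      induction e with
      | _ a b => exact ⟨a, by simp⟩
    have hsum : vertexSum G γ v = vertexSum G γ' v := by rw [hγ.2.2, hγ'.2.2]
    have := (Finset.sum_eq_sum_iff_of_le fun e _ => by
      split_ifs
      · exact hle e
      · exact le_rfl).1 hsum e (by simpa using he)
    simpa [hv] using this.symm
  · rw [hγ.2.1 e he, hγ'.2.1 e he]

theorem IsFPM.le_one {γ : Sym2 V → ℝ} (hγ : IsFPM G γ) (e : Sym2 V) : γ e ≤ 1 := by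
  by_cases he : e ∈ G.edgeSet
  · obtain ⟨v, hv⟩ : ∃ v, v ∈ e := by
      induction e with
      | _ a b => exact ⟨a, by simp⟩
    have := Finset.single_le_sum (f := fun e => if v ∈ e then γ e else 0)
      (fun e _ => by
        split_ifs
        · exact hγ.1 e
        · exact le_rfl) (SimpleGraph.mem_edgeFinset.2 he)
    rw [← hγ.2.2 v]
    simpa [hv, vertexSum] using this
  · simp [hγ.2.1 e he]

theorem ffN_le_eSum {α γ : Sym2 V → ℝ} (hα : IsForcing G α γ) : ffN G γ ≤ eSum G α := by
  refine csInf_le ⟨0, ?_⟩ ⟨α, hα, rfl⟩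
  rintro _ ⟨β, hβ, rfl⟩
  exact Finset.sum_nonneg fun e _ => hβ.1 e

theorem ffN_le_ffMax {γ : Sym2 V → ℝ} (hγ : IsFPM G γ) : ffN G γ ≤ ffMax G := by
  refine le_csSup ⟨∑ e ∈ G.edgeFinset, (1 : ℝ), ?_⟩ ⟨γ, hγ, rfl⟩
  rintro _ ⟨δ, hδ, rfl⟩
  exact (ffN_le_eSum hδ.isForcing_self).trans (Finset.sum_le_sum fun e _ => hδ.le_one e)

theorem IsForcingSet.ffN_le_eSum_indicator_map_iso {T : Set (Sym2 V)} (hT : IsForcingSet G T)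
    {γ : Sym2 V → ℝ} (hγ : IsFPM G γ) (σ : G ≃g G) :
    ffN G γ ≤ eSum G (T.indicator fun e => γ (Sym2.map σ e)) := by
  refine (ffN_le_eSum ((hT.preimage_map_iso σ.symm).isForcing_indicator hγ)).trans_eq ?_
  rw [eSum, eSum, ← sum_edgeFinset_map_iso G σ]
  refine Finset.sum_congr rfl fun e _ => ?_
  have hinv : Sym2.map σ.symm (Sym2.map σ e) = e := by
    induction e with
    | _ a b => simp
  classical
  simp [Set.indicator_apply, hinv]

theorem IsFPM.average {S : Finset (G ≃g G)} (hS : S.Nonempty) {γ : Sym2 V → ℝ}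
    (hγ : IsFPM G γ) :
    IsFPM G (fun e => (1 / (S.card : ℝ)) * ∑ σ ∈ S, γ (Sym2.map σ e)) := by
  have hcard : (S.card : ℝ) ≠ 0 := by exact_mod_cast hS.card_pos.ne'
  refine ⟨fun e => mul_nonneg (by positivity) (Finset.sum_nonneg fun σ _ => hγ.1 _),
    fun e he => ?_, fun v => ?_⟩
  · exact mul_eq_zero_of_right _ <| Finset.sum_eq_zero fun σ _ => hγ.2.1 _ <| by
      rwa [map_iso_mem_edgeSet_iff]
  · rw [vertexSum_average G S _ fun σ e => γ (Sym2.map σ e)]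
    simp [vertexSum_map_iso, hγ.2.2, hcard]

theorem IsFPM.ffN_le_ffN_average {S : Finset (G ≃g G)} (hS : S.Nonempty) {γ : Sym2 V → ℝ}
    (hγ : IsFPM G γ) :
    ffN G γ ≤ ffN G (fun e => (1 / (S.card : ℝ)) * ∑ σ ∈ S, γ (Sym2.map σ e)) := by
  have hcard : (0 : ℝ) < S.card := by exact_mod_cast hS.card_pos
  have hγ₀ := hγ.average hS
  set γ₀ : Sym2 V → ℝ := fun e => (1 / (S.card : ℝ)) * ∑ σ ∈ S, γ (Sym2.map σ e) with hdef
  refine le_csInf ⟨_, γ₀, hγ₀.isForcing_self, rfl⟩ ?_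
  rintro _ ⟨α, hα, rfl⟩
  set T : Set (Sym2 V) := {e | α e = γ₀ e} with hTdef
  have hT : IsForcingSet G T := hα.isForcingSet_tight hγ₀
  calc ffN G γ = (1 / (S.card : ℝ)) * ∑ _σ ∈ S, ffN G γ := by
        rw [Finset.sum_const, nsmul_eq_mul]; field_simp
    _ ≤ (1 / (S.card : ℝ)) * ∑ σ ∈ S, eSum G (T.indicator fun e => γ (Sym2.map σ e)) := by
        gcongr with σ
        exact hT.ffN_le_eSum_indicator_map_iso hγ σ
    _ = eSum G (T.indicator γ₀) := by
        simp only [eSum]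
        rw [Finset.sum_comm, Finset.mul_sum]
        refine Finset.sum_congr rfl fun e _ => ?_
        by_cases he : e ∈ T <;> simp [he, hdef]
    _ ≤ eSum G α := by
        refine Finset.sum_le_sum fun e _ => ?_
        by_cases he : e ∈ T
        · rw [Set.indicator_of_mem he]
          exact le_of_eq he.symm
        · rw [Set.indicator_of_notMem he]
          exact hα.1 e

end Averaging

/-- If `γ` is a fractional perfect matching with maximum fractional forcing number and
`S` is a nonempty finite set of automorphisms of `G`, then the average
`γ₀ = (1/|S|) Σ_{σ ∈ S} γ_σ` is a fractional perfect matching and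
`f_f(G,γ₀) = f_f(G,γ)`. -/
theorem ffN_average_of_max (G : SimpleGraph V) [DecidableRel G.Adj]
    (S : Finset (G ≃g G)) (hS : S.Nonempty)
    (γ : Sym2 V → ℝ) (hγ : IsFPM G γ) (hmax : ffN G γ = ffMax G) :
    IsFPM G (fun e => (1 / (S.card : ℝ)) * ∑ σ ∈ S, γ (Sym2.map σ e)) ∧
      ffN G (fun e => (1 / (S.card : ℝ)) * ∑ σ ∈ S, γ (Sym2.map σ e)) = ffN G γ := by
  exact ⟨hγ.average hS, le_antisymm (hmax ▸ ffN_le_ffMax (hγ.average hS))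
    (hγ.ffN_le_ffN_average hS)⟩
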